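/- arXiv:2407.14471 — 4 statements merged into one kernel-verified Lean document; each statement's English description precedes it below -/
import Mathlib

section
/- Let Y be a linear subspace of a smooth real Banach space X. Then Y is an anti-coproximinal subspace of X if and only if the closure of the linear span of 𝒥_Y in the weak*-topology of X* equals X*. -/
open Metric Set

variable {X : Type*} [NormedAddCommGroup X] [NormedSpace ℝ X]

/-- `J(x)`: the set of norm-one support functionals of `x`. -/
def normingSet (x : X) : Set (X →L[ℝ] ℝ) := {f | ‖f‖ = 1 ∧ f x = ‖x‖}

/-- `y₀` is a best coapproximation to `x` out of `Y`. -/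
def IsBestCoapprox (Y : Submodule ℝ X) (x y₀ : X) : Prop :=
  ∀ y ∈ Y, ‖y₀ - y‖ ≤ ‖x - y‖

/-- `Y` is an anti-coproximinal subspace of `X`. -/
def AntiCoproximinal (Y : Submodule ℝ X) : Prop :=
  ∀ x ∉ Y, ¬ ∃ y₀ ∈ Y, IsBestCoapprox Y x y₀

/-- Approximate Birkhoff-James orthogonality: `u ⊥_B^ε v`. -/
def ApproxBJOrth (ε : ℝ) (u v : X) : Prop :=
  ∀ t : ℝ, ‖u + t • v‖ ≥ ‖u‖ - ε * ‖t • v‖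

/-- `y₀` is an `ε`-best coapproximation to `x` out of `Y`. -/
def IsEpsBestCoapprox (Y : Submodule ℝ X) (ε : ℝ) (x y₀ : X) : Prop :=
  ∀ y ∈ Y, ApproxBJOrth ε y (x - y₀)

/-- `Y` is a strongly anti-coproximinal subspace of `X`. -/
def StronglyAntiCoproximinal (Y : Submodule ℝ X) : Prop :=
  ∀ x ∉ Y, ∀ ε : ℝ, 0 ≤ ε → ε < 1 → ¬ ∃ y₀ ∈ Y, IsEpsBestCoapprox Y ε x y₀

/-- `x` is a smooth point: nonzero and `J(x)` is a singleton. -/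
def SmoothPt (x : X) : Prop := x ≠ 0 ∧ ∃ f, normingSet x = {f}

/-- A smooth Banach space: every nonzero point is a smooth point. -/
def SmoothSpace (X : Type*) [NormedAddCommGroup X] [NormedSpace ℝ X] : Prop :=
  ∀ x : X, x ≠ 0 → SmoothPt x

/-- `𝒥_Y`: norm-one functionals supporting some norm-one smooth point of `Y`. -/
def JsetY (Y : Submodule ℝ X) : Set (X →L[ℝ] ℝ) :=
  {f | ‖f‖ = 1 ∧ ∃ y ∈ Y, SmoothPt y ∧ ‖y‖ = 1 ∧ f y = 1}

/-- The Kadets-Klee property. -/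
def KadetsKlee (Z : Type*) [NormedAddCommGroup Z] [NormedSpace ℝ Z] : Prop :=
  ∀ (z : ℕ → Z) (z₀ : Z),
    (∀ f : Z →L[ℝ] ℝ, Filter.Tendsto (fun k => f (z k)) Filter.atTop (nhds (f z₀))) →
    Filter.Tendsto (fun k => ‖z k‖) Filter.atTop (nhds ‖z₀‖) →
    Filter.Tendsto z Filter.atTop (nhds z₀)

/-- Birkhoff-James orthogonality yields a support functional vanishing at `z`. -/
theorem exists_norming_of_orth {y z : X} (hy : y ≠ 0) (h : ∀ t : ℝ, ‖y‖ ≤ ‖y + t • z‖) :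
    ∃ f ∈ normingSet y, f z = 0 := by
  let S : Submodule ℝ X := Submodule.span ℝ {z}
  have hS : IsClosed (S : Set X) := Submodule.closed_of_finiteDimensional S
  obtain ⟨g, hg, hgy⟩ := exists_dual_vector'' ℝ (S.mkQL y)
  have hn : ‖y‖ ≤ ‖S.mkQL y‖ := by
    refine QuotientAddGroup.le_norm_iff.2 ?_
    intro m hm
    have : m - y ∈ S := (Submodule.Quotient.eq S).1 hm
    obtain ⟨t, ht⟩ := Submodule.mem_span_singleton.1 this
    have := h t
    rwa [ht, add_sub_cancel] at this
  have hle : ∀ x, ‖S.mkQL x‖ ≤ ‖x‖ := fun x => Submodule.Quotient.norm_mk_le S x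
  have hpos : 0 < ‖y‖ := norm_pos_iff.2 hy
  have hfy : (g.comp S.mkQL) y = ‖y‖ := by
    have : g (S.mkQL y) = ‖S.mkQL y‖ := hgy
    rw [ContinuousLinearMap.comp_apply, this]
    exact le_antisymm (hle y) hn
  refine ⟨g.comp S.mkQL, ⟨le_antisymm ?_ ?_, hfy⟩, ?_⟩
  · refine ContinuousLinearMap.opNorm_le_bound _ zero_le_one fun x => ?_
    calc ‖g (S.mkQL x)‖ ≤ ‖g‖ * ‖S.mkQL x‖ := g.le_opNorm _
      _ ≤ 1 * ‖x‖ := mul_le_mul hg (hle x) (norm_nonneg _) zero_le_one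
  · have := (g.comp S.mkQL).le_opNorm y
    rw [hfy, norm_norm] at this
    exact le_of_mul_le_mul_right (by linarith) hpos
  · have : S.mkQL z = 0 := (Submodule.Quotient.mk_eq_zero S).2 (Submodule.mem_span_singleton_self z)
    rw [ContinuousLinearMap.comp_apply, this, map_zero]

/-- Weak-star density of a subspace of the dual is triviality of its pre-annihilator. -/
theorem weakStar_dense_iff (W : Submodule ℝ (X →L[ℝ] ℝ)) :
    closure (⇑StrongDual.toWeakDual '' (W : Set (X →L[ℝ] ℝ))) = (Set.univ : Set (WeakDual ℝ X)) ↔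
      ∀ z : X, (∀ f ∈ W, f z = 0) → z = 0 := by
  constructor
  · intro h z hz
    by_contra hne
    obtain ⟨g, -, hg⟩ := exists_dual_vector ℝ z (norm_ne_zero_iff.2 hne)
    have hcl : IsClosed {f : WeakDual ℝ X | f z = 0} :=
      isClosed_eq (WeakDual.eval_continuous z) continuous_const
    have hsub : closure (⇑StrongDual.toWeakDual '' (W : Set (X →L[ℝ] ℝ))) ⊆
        {f : WeakDual ℝ X | f z = 0} := by
      refine closure_minimal ?_ hcl
      rintro _ ⟨f, hf, rfl⟩
      exact hz f hf
    rw [h] at hsub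
    have h0 : g z = 0 := hsub (Set.mem_univ (StrongDual.toWeakDual g))
    rw [h0] at hg
    exact hne (norm_eq_zero.1 hg.symm)
  · intro h
    rw [Set.eq_univ_iff_forall]
    intro g
    by_contra hg
    let W' : Submodule ℝ (WeakDual ℝ X) := W.map (StrongDual.toWeakDual (𝕜 := ℝ) (E := X)).toLinearMap
    have hW' : (⇑StrongDual.toWeakDual '' (W : Set (X →L[ℝ] ℝ))) = (W' : Set (WeakDual ℝ X)) := rfl
    rw [hW'] at hg
    haveI : LocallyConvexSpace ℝ (WeakDual ℝ X) :=
      WeakBilin.locallyConvexSpace (B := topDualPairing ℝ X)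
    obtain ⟨φ, u, h1, h2⟩ := geometric_hahn_banach_closed_point W'.convex.closure
      isClosed_closure hg
    obtain ⟨z, hz⟩ := LinearMap.dualEmbedding_surjective (topDualPairing ℝ X) φ
    have hφ : ∀ f : WeakDual ℝ X, φ f = f z := fun f => by rw [← hz]; rfl
    have hu : 0 < u := by
      have := h1 0 (subset_closure W'.zero_mem)
      rwa [map_zero] at this
    have hz0 : z = 0 := by
      refine h z fun f hf => ?_
      by_contra hne
      have := h1 ((u / f z) • StrongDual.toWeakDual f)
        (subset_closure (W'.smul_mem _ ⟨f, hf, rfl⟩))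
      rw [map_smul, hφ] at this
      have e : (StrongDual.toWeakDual f : WeakDual ℝ X) z = f z := rfl
      rw [e, smul_eq_mul, div_mul_cancel₀ _ hne] at this
      exact lt_irrefl _ this
    rw [hφ, hz0, map_zero] at h2
    exact lt_asymm hu h2

theorem antiCoproximinal_iff_weakStar_span_dense [CompleteSpace X]
    (hsm : SmoothSpace X) (Y : Submodule ℝ X) :
    AntiCoproximinal Y ↔
      closure (⇑StrongDual.toWeakDual ''
          ((Submodule.span ℝ (JsetY Y) : Submodule ℝ (X →L[ℝ] ℝ)) : Set (X →L[ℝ] ℝ))) =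
        (Set.univ : Set (WeakDual ℝ X)) := by
  rw [weakStar_dense_iff]
  constructor
  · intro h z hz
    by_contra hne
    -- for `y ∈ Y` the functional supporting `y` vanishes at `z`
    have key : ∀ y ∈ Y, y ≠ 0 → ∃ f : X →L[ℝ] ℝ, ‖f‖ = 1 ∧ f y = ‖y‖ ∧ f z = 0 := by
      intro y hy hy0
      obtain ⟨f, hf, hfy⟩ := exists_dual_vector ℝ y (norm_ne_zero_iff.2 hy0)
      have hfy' : f y = ‖y‖ := hfy
      refine ⟨f, hf, hfy', hz f (Submodule.subset_span ?_)⟩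
      have hn : ‖y‖ ≠ 0 := norm_ne_zero_iff.2 hy0
      refine ⟨hf, ‖y‖⁻¹ • y, Y.smul_mem _ hy, hsm _ (smul_ne_zero (inv_ne_zero hn) hy0), ?_, ?_⟩
      · rw [norm_smul, norm_inv, norm_norm, inv_mul_cancel₀ hn]
      · rw [map_smul, hfy', smul_eq_mul, inv_mul_cancel₀ hn]
    have hzY : z ∉ Y := by
      intro hzY
      obtain ⟨f, -, h1, h2⟩ := key z hzY hne
      rw [h2] at h1
      exact hne (norm_eq_zero.1 h1.symm)
    refine h z hzY ⟨0, Y.zero_mem, fun y hy => ?_⟩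
    rw [zero_sub, norm_neg]
    by_cases hy0 : y = 0
    · simp [hy0]
    obtain ⟨f, hf, hfy, hfz⟩ := key y hy hy0
    have := f.le_opNorm (z - y)
    rwa [map_sub, hfz, hfy, zero_sub, norm_neg, norm_norm, hf, one_mul] at this
  · rintro h x hx ⟨y₀, hy₀, hb⟩
    have hx0 : x - y₀ = 0 := by
      refine h _ fun f hf => ?_
      have hle : Submodule.span ℝ (JsetY Y) ≤
          LinearMap.ker (ContinuousLinearMap.apply ℝ ℝ (x - y₀)).toLinearMap := by
        rw [Submodule.span_le]
        rintro f ⟨hf, y, hy, ⟨hy0, f', hf'⟩, hy1, hfy⟩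
        obtain ⟨k, hk, hkz⟩ := exists_norming_of_orth (y := y) (z := x - y₀) hy0 (by
          intro t
          by_cases ht : t = 0
          · simp [ht]
          have := hb (y₀ - t⁻¹ • y) (Y.sub_mem hy₀ (Y.smul_mem _ hy))
          have e1 : y = t • (y₀ - (y₀ - t⁻¹ • y)) := by
            rw [sub_sub_cancel, smul_inv_smul₀ ht]
          have e2 : y + t • (x - y₀) = t • (x - (y₀ - t⁻¹ • y)) := by
            rw [← sub_add, smul_add, smul_inv_smul₀ ht, add_comm]
          rw [e2, norm_smul]
          calc ‖y‖ = ‖t‖ * ‖y₀ - (y₀ - t⁻¹ • y)‖ := by rw [← norm_smul, ← e1]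
            _ ≤ _ := mul_le_mul_of_nonneg_left this (norm_nonneg _))
        have hfm : f ∈ normingSet y := ⟨hf, by rw [hfy, hy1]⟩
        rw [hf'] at hk hfm
        have : f = k := hfm.trans hk.symm
        change f (x - y₀) = 0
        rw [this, hkz]
      exact hle hf
    exact hx (by rw [sub_eq_zero.1 hx0]; exact hy₀)
end

section
/- Let X be a reflexive real Banach space whose dual X* satisfies the Kadets-Klee property, and let Y be a closed linear subspace of X such that there exists a rotund point of the unit ball of X lying in S_X \ S_Y (the unit sphere of X but not the unit sphere of Y). Then Y is not a strongly anti-coproximinal subspace of X. -/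
open Metric Set

variable {X : Type*} [NormedAddCommGroup X] [NormedSpace ℝ X]

theorem aux_ultra {E : Type*} [NormedAddCommGroup E] [NormedSpace ℝ E] {ι : Type*}
    (U : Ultrafilter ι) (f : ι → StrongDual ℝ E) (hf : ∀ i, ‖f i‖ ≤ 1) :
    ∃ g : StrongDual ℝ E, ‖g‖ ≤ 1 ∧
      ∀ x, Filter.Tendsto (fun i => f i x) U (nhds (g x)) := by
  have hc := WeakDual.isCompact_closedBall (𝕜 := ℝ) (E := E) (0 : StrongDual ℝ E) 1
  have hU : ((U.map (fun i => StrongDual.toWeakDual (f i)) : Ultrafilter (WeakDual ℝ E)) :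
      Filter (WeakDual ℝ E)) ≤ Filter.principal
        (WeakDual.toStrongDual ⁻¹' Metric.closedBall (0 : StrongDual ℝ E) 1) := by
    rw [Filter.le_principal_iff]
    refine Filter.mem_map.2 (Filter.univ_mem' fun i => ?_)
    simpa using hf i
  obtain ⟨g, hg, hgl⟩ := hc.ultrafilter_le_nhds _ hU
  refine ⟨WeakDual.toStrongDual g, by simpa using hg, fun x => ?_⟩
  have ht : Filter.Tendsto (fun i => StrongDual.toWeakDual (f i)) U (nhds g) := hgl
  exact ((WeakDual.eval_continuous x).tendsto g).comp ht

theorem aux_norming {E : Type*} [NormedAddCommGroup E] [NormedSpace ℝ E]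
    (d : StrongDual ℝ E) : ∃ x : E, ‖x‖ ≤ 1 ∧ ‖d‖ ≤ 2 * |d x| := by
  by_cases h : d = 0
  · exact ⟨0, by simp, by simp [h]⟩
  · have hp : 0 < ‖d‖ := norm_pos_iff.2 h
    obtain ⟨x, hx, hd⟩ := d.exists_lt_apply_of_lt_opNorm (show ‖d‖ / 2 < ‖d‖ by linarith)
    rw [Real.norm_eq_abs] at hd
    exact ⟨x, hx.le, by linarith⟩

theorem aux_seq {E : Type*} [NormedAddCommGroup E] [NormedSpace ℝ E]
    (hrefl : Function.Surjective (NormedSpace.inclusionInDoubleDual ℝ E))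
    (f : ℕ → StrongDual ℝ E) (hf : ∀ i, ‖f i‖ ≤ 1) :
    ∃ (φ : ℕ → ℕ) (g : StrongDual ℝ E), StrictMono φ ∧ ‖g‖ ≤ 1 ∧
      ∀ x, Filter.Tendsto (fun i => f (φ i) x) Filter.atTop (nhds (g x)) := by
  choose ξ hξ1 hξ2 using aux_norming (E := E)
  obtain ⟨c, hcc, hcs⟩ : TopologicalSpace.IsSeparable
      (Submodule.span ℝ (Set.range f) : Set (StrongDual ℝ E)) :=
    (Set.countable_range f).isSeparable.span
  have hcne : c.Nonempty := by
    rw [← closure_nonempty_iff]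
    exact ⟨0, hcs (Submodule.zero_mem _)⟩
  obtain ⟨d, rfl⟩ := hcc.exists_eq_range hcne
  -- diagonal subsequence
  have hK : IsCompact (Set.pi Set.univ (fun _ : ℕ => Set.Icc (-1 : ℝ) 1)) :=
    isCompact_univ_pi fun _ => isCompact_Icc
  have hmem : ∀ n, (fun k => f n (ξ (d k))) ∈ Set.pi Set.univ (fun _ : ℕ => Set.Icc (-1 : ℝ) 1) := by
    intro n k _
    have h1 : |f n (ξ (d k))| ≤ 1 := by
      have h2 := (f n).le_opNorm (ξ (d k))
      rw [Real.norm_eq_abs] at h2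
      have h3 := hf n
      have h4 := hξ1 (d k)
      nlinarith [norm_nonneg (f n), norm_nonneg (ξ (d k))]
    exact abs_le.1 h1
  obtain ⟨a, -, φ, hφ, ha⟩ := hK.tendsto_subseq hmem
  rw [tendsto_pi_nhds] at ha
  let M := (Submodule.span ℝ (Set.range f)).topologicalClosure
  have hM : ∀ (U : Ultrafilter ℕ) (g : StrongDual ℝ E),
      (∀ x, Filter.Tendsto (fun i => f (φ i) x) U (nhds (g x))) → g ∈ M := by
    intro U g hg
    by_contra hgM
    obtain ⟨Φ, u, hΦ1, hΦ2⟩ := geometric_hahn_banach_closed_point (E := StrongDual ℝ E)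
      (s := (M : Set (StrongDual ℝ E))) M.convex
      (Submodule.isClosed_topologicalClosure _) hgM
    obtain ⟨x, rfl⟩ := hrefl Φ
    have hle : g x ≤ u := by
      refine le_of_tendsto (hg x) (Filter.Eventually.of_forall fun i => ?_)
      exact (hΦ1 (f (φ i)) (Submodule.le_topologicalClosure _
        (Submodule.subset_span (Set.mem_range_self _)))).le
    exact absurd hΦ2 (not_lt.2 hle)
  have huniq : ∀ g ∈ M, (∀ k, g (ξ (d k)) = 0) → g = 0 := by
    intro g hg h0
    have hgc : g ∈ closure (Set.range d) := by
      have : closure (Submodule.span ℝ (Set.range f) : Set (StrongDual ℝ E))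
          ⊆ closure (Set.range d) := closure_minimal hcs isClosed_closure
      exact this hg
    rw [← norm_le_zero_iff]
    refine le_of_forall_pos_le_add fun δ hδ => ?_
    obtain ⟨_, ⟨k, rfl⟩, hk⟩ := Metric.mem_closure_iff.1 hgc (δ / 3) (by positivity)
    rw [dist_eq_norm] at hk
    have h1 := hξ2 (d k)
    have h2 := (g - d k).le_opNorm (ξ (d k))
    rw [sub_apply, h0 k, zero_sub, norm_neg, Real.norm_eq_abs] at h2
    have h3 := hξ1 (d k)
    have h4 : ‖g‖ ≤ ‖g - d k‖ + ‖d k‖ := by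
      simpa using norm_add_le (g - d k) (d k)
    have h5 : ‖g - d k‖ * ‖ξ (d k)‖ ≤ ‖g - d k‖ := mul_le_of_le_one_right (norm_nonneg _) h3
    linarith
  obtain ⟨g, hg1, hg⟩ := aux_ultra (Filter.hyperfilter ℕ) (fun i => f (φ i)) (fun i => hf _)
  refine ⟨φ, g, hφ, hg1, fun x => ?_⟩
  rw [Filter.tendsto_iff_ultrafilter]
  intro U hU
  obtain ⟨h, -, hh⟩ := aux_ultra U (fun i => f (φ i)) (fun i => hf _)
  have heq : h - g = 0 := by
    refine huniq _ (Submodule.sub_mem _ (hM U h hh) (hM _ g hg)) fun k => ?_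
    have e1 := tendsto_nhds_unique (hh (ξ (d k))) ((ha k).mono_left hU)
    have e2 := tendsto_nhds_unique (hg (ξ (d k)))
      ((ha k).mono_left Nat.hyperfilter_le_atTop)
    rw [sub_apply, e1, e2, sub_self]
  rw [← sub_eq_zero.1 heq]
  exact hh x

theorem aux_point {E : Type*} [NormedAddCommGroup E] [NormedSpace ℝ E] (Y : Submodule ℝ E)
    (x : E) (ε : ℝ) (hε : 0 ≤ ε) (h : ¬ IsEpsBestCoapprox Y ε x 0) (hx : ‖x‖ = 1) :
    ∃ z ∈ Y, ‖z‖ ≤ 1 ∧ ∃ f : StrongDual ℝ E, ‖f‖ = 1 ∧ f z = 1 ∧ ε < f x := by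
  simp only [IsEpsBestCoapprox, ApproxBJOrth, sub_zero, not_forall, not_le, ge_iff_le] at h
  obtain ⟨y, hy, t, ht⟩ := h
  rw [norm_smul, hx, mul_one, Real.norm_eq_abs] at ht
  have hy0 : y ≠ 0 := by
    rintro rfl
    simp only [zero_add, norm_zero, zero_sub] at ht
    nlinarith [norm_nonneg (t • x), abs_nonneg t]
  obtain ⟨f, hf1, hfy⟩ := exists_dual_vector ℝ y (norm_ne_zero_iff.2 hy0)
  have hfy' : f y = ‖y‖ := by simpa using hfy
  have hyp : 0 < ‖y‖ := norm_pos_iff.2 hy0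
  have h1 : f (y + t • x) ≤ ‖y + t • x‖ := by
    have := f.le_opNorm (y + t • x)
    rw [hf1, one_mul] at this
    exact (le_abs_self _).trans this
  rw [map_add, map_smul, smul_eq_mul, hfy'] at h1
  have h2 : t * f x < - (ε * |t|) := by linarith
  have hn : ‖(‖y‖⁻¹ : ℝ) • y‖ = 1 := by
    rw [norm_smul, norm_inv, norm_norm, inv_mul_cancel₀ hyp.ne']
  have hfn : f ((‖y‖⁻¹ : ℝ) • y) = 1 := by
    rw [map_smul, smul_eq_mul, hfy', inv_mul_cancel₀ hyp.ne']
  rcases lt_trichotomy t 0 with h3 | h3 | h3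
  · refine ⟨_, Y.smul_mem _ hy, hn.le, f, hf1, hfn, ?_⟩
    rw [abs_of_neg h3] at h2
    nlinarith
  · simp [h3] at h2
  · refine ⟨_, Y.neg_mem (Y.smul_mem _ hy), (norm_neg _).trans_le hn.le, -f,
      (norm_neg f).trans hf1, ?_, ?_⟩
    · rw [neg_apply, map_neg, neg_neg, hfn]
    · rw [abs_of_pos h3] at h2
      rw [neg_apply]
      nlinarith

theorem not_stronglyAntiCoproximinal_of_rotund_point [CompleteSpace X]
    (hrefl : Function.Surjective (NormedSpace.inclusionInDoubleDual ℝ X))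
    (hKK : KadetsKlee (StrongDual ℝ X))
    (Y : Submodule ℝ X) (hYclosed : IsClosed (Y : Set X))
    (x : X) (hx : ‖x‖ = 1) (hxY : x ∉ Y)
    (hrotund : ∀ y : X, ‖y‖ = 1 → ‖((1 : ℝ) / 2) • (x + y)‖ = 1 → y = x) :
    ¬ StronglyAntiCoproximinal Y := by
  intro hS
  have hex : ∀ n : ℕ, ∃ z ∈ Y, ‖z‖ ≤ 1 ∧ ∃ f : StrongDual ℝ X,
      ‖f‖ = 1 ∧ f z = 1 ∧ 1 - 1 / ((n : ℝ) + 1) < f x := by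
    intro n
    have hp : (0 : ℝ) < 1 / ((n : ℝ) + 1) := by positivity
    have hl : 1 / ((n : ℝ) + 1) ≤ 1 := by
      rw [div_le_one (by positivity)]
      linarith [(Nat.cast_nonneg n : (0 : ℝ) ≤ n)]
    refine aux_point Y x _ (by linarith) (fun hc => ?_) hx
    exact hS x hxY _ (by linarith) (by linarith) ⟨0, Y.zero_mem, hc⟩
  choose z hzY hz1 f hf1 hfz hfx using hex
  obtain ⟨φ, g, hφ, hg1, hg⟩ := aux_seq hrefl f (fun i => (hf1 i).le)
  have hgx : 1 ≤ g x := by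
    have hl : Filter.Tendsto (fun n : ℕ => 1 - 1 / ((φ n : ℝ) + 1)) Filter.atTop (nhds 1) := by
      have := (tendsto_one_div_add_atTop_nhds_zero_nat (𝕜 := ℝ)).comp hφ.tendsto_atTop
      simpa using this.const_sub 1
    exact le_of_tendsto_of_tendsto' hl (hg x) fun n => (hfx _).le
  have hgle : ∀ v, g v ≤ ‖v‖ := fun v => by
    have := g.le_opNorm v
    have h2 := le_abs_self (g v)
    rw [Real.norm_eq_abs] at this
    nlinarith [norm_nonneg v]
  have hgn : ‖g‖ = 1 := by
    refine le_antisymm hg1 ?_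
    have := g.le_opNorm x
    rw [hx, mul_one, Real.norm_eq_abs] at this
    linarith [le_abs_self (g x)]
  have hconv : Filter.Tendsto (fun n => f (φ n)) Filter.atTop (nhds g) := by
    refine hKK _ _ (fun Φ => ?_) (by simp [hf1, hgn])
    obtain ⟨v, rfl⟩ := hrefl Φ
    exact hg v
  obtain ⟨Φ, hΦ1, hΦ⟩ := aux_ultra (Filter.hyperfilter ℕ)
    (fun n => NormedSpace.inclusionInDoubleDual ℝ X (z (φ n)))
    (fun n => (NormedSpace.double_dual_bound ℝ X _).trans (hz1 _))
  obtain ⟨y, rfl⟩ := hrefl Φ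
  simp only [NormedSpace.dual_def] at hΦ
  have hyn : ‖y‖ ≤ 1 := by
    have : ‖NormedSpace.inclusionInDoubleDual ℝ X y‖ = ‖y‖ :=
      (NormedSpace.inclusionInDoubleDualLi (E := X) ℝ).norm_map y
    rwa [this] at hΦ1
  have hyY : y ∈ Y := by
    by_contra hc
    obtain ⟨h, u, h1, h2⟩ := geometric_hahn_banach_closed_point (E := X)
      (s := (Y : Set X)) Y.convex hYclosed hc
    have : h y ≤ u := le_of_tendsto (hΦ h) (Filter.Eventually.of_forall fun i => (h1 _ (hzY _)).le)
    linarith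
  have hgy : 1 ≤ g y := by
    have hd : Filter.Tendsto (fun n => ‖g - f (φ n)‖) Filter.atTop (nhds 0) := by
      have := (hconv.const_sub g).norm
      simpa using this
    have hl : Filter.Tendsto (fun n => 1 - ‖g - f (φ n)‖) (Filter.hyperfilter ℕ) (nhds 1) := by
      have := (hd.const_sub 1).mono_left Nat.hyperfilter_le_atTop
      simpa using this
    refine le_of_tendsto_of_tendsto' hl (hΦ g) fun n => ?_
    have h1 := (g - f (φ n)).le_opNorm (z (φ n))
    rw [sub_apply, hfz, Real.norm_eq_abs] at h1
    have h2 := neg_abs_le (g (z (φ n)) - 1)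
    have h3 : ‖g - f (φ n)‖ * ‖z (φ n)‖ ≤ ‖g - f (φ n)‖ :=
      mul_le_of_le_one_right (norm_nonneg _) (hz1 _)
    linarith
  have hy1 : ‖y‖ = 1 := le_antisymm hyn (hgy.trans (hgle y))
  have hmid : ‖((1 : ℝ) / 2) • (x + y)‖ = 1 := by
    refine le_antisymm ?_ ?_
    · rw [norm_smul, Real.norm_of_nonneg (by norm_num)]
      have := norm_add_le x y
      linarith
    · have := hgle (((1 : ℝ) / 2) • (x + y))
      rw [map_smul, map_add, smul_eq_mul] at this
      linarith
  exact hxY (hrotund y hy1 hmid ▸ hyY)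
end

section
/- Let X be a reflexive strictly convex real Banach space whose dual X* satisfies the Kadets-Klee property. Then no proper closed linear subspace of X is a strongly anti-coproximinal subspace of X. -/
open Metric Set

variable {X : Type*} [NormedAddCommGroup X] [NormedSpace ℝ X]

open Filter Topology

lemma aux_sep {E : Type*} [NormedAddCommGroup E] [NormedSpace ℝ E] (p : Submodule ℝ E)
    (hp : IsClosed (p : Set E)) (x : E) (hx : x ∉ p) :
    ∃ f : StrongDual ℝ E, f x ≠ 0 ∧ ∀ y ∈ p, f y = 0 := by
  obtain ⟨f, u, h1, h2⟩ := geometric_hahn_banach_closed_point (s := (p : Set E)) (x := x)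
    p.convex hp hx
  have h0 : ∀ y ∈ p, f y = 0 := by
    intro y hy
    by_contra hne
    have := h1 ((u / f y) • y) (p.smul_mem _ hy)
    rw [map_smul, smul_eq_mul, div_mul_cancel₀ _ hne] at this
    exact lt_irrefl _ this
  refine ⟨f, ?_, h0⟩
  have := h1 0 p.zero_mem
  rw [map_zero] at this
  exact (this.trans h2).ne'

lemma aux_cluster {E : Type*} [NormedAddCommGroup E] [NormedSpace ℝ E]
    {f : ℕ → WeakDual ℝ E} {g : WeakDual ℝ E} (hg : MapClusterPt g atTop f) (x : E) (c : ℝ)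
    (hc : Tendsto (fun n => f n x) atTop (𝓝 c)) : g x = c := by
  have h : MapClusterPt (g x) atTop (fun n => f n x) :=
    hg.continuousAt_comp (f := fun q : WeakDual ℝ E => q x)
      (WeakDual.eval_continuous x).continuousAt
  have h2 : (𝓝 (g x) ⊓ 𝓝 c).NeBot := NeBot.mono h (inf_le_inf_left _ hc)
  exact eq_of_nhds_neBot h2

lemma aux_attain {X : Type*} [NormedAddCommGroup X] [NormedSpace ℝ X]
    (hrefl : Function.Surjective (NormedSpace.inclusionInDoubleDual ℝ X))
    (g : StrongDual ℝ X) : ∃ z : X, ‖z‖ ≤ 1 ∧ g z = ‖g‖ := by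
  obtain ⟨Φ, h1, h2⟩ := exists_dual_vector'' ℝ g
  obtain ⟨z, rfl⟩ := hrefl Φ
  refine ⟨z, ?_, ?_⟩
  · have := (NormedSpace.inclusionInDoubleDualLi (E := X) ℝ).norm_map z
    rw [← this]; exact h1
  · simpa using h2

lemma aux_ball {X : Type*} [NormedAddCommGroup X] [NormedSpace ℝ X]
    (hrefl : Function.Surjective (NormedSpace.inclusionInDoubleDual ℝ X))
    (y : ℕ → X) (hy : ∀ n, ‖y n‖ ≤ 1) :
    ∃ z : X, ‖z‖ ≤ 1 ∧ ∀ (h : StrongDual ℝ X) (c : ℝ),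
      Tendsto (fun n => h (y n)) atTop (𝓝 c) → h z = c := by
  have hK := WeakDual.isCompact_closedBall (𝕜 := ℝ) (E := StrongDual ℝ X) 0 1
  have hmem : ∀ n, (StrongDual.toWeakDual (NormedSpace.inclusionInDoubleDual ℝ X (y n))) ∈
      WeakDual.toStrongDual ⁻¹' closedBall (0 : StrongDual ℝ (StrongDual ℝ X)) 1 := by
    intro n
    refine (mem_closedBall_zero_iff (E := StrongDual ℝ (StrongDual ℝ X))).mpr ?_
    exact (NormedSpace.double_dual_bound ℝ X (y n)).trans (hy n)
  obtain ⟨Ψ, hΨ, hcl⟩ := hK.exists_mapClusterPt (f := atTop)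
    (u := fun n => StrongDual.toWeakDual (NormedSpace.inclusionInDoubleDual ℝ X (y n)))
    (tendsto_principal.mpr (Eventually.of_forall hmem))
  obtain ⟨z, hz⟩ := hrefl (WeakDual.toStrongDual Ψ)
  refine ⟨z, ?_, ?_⟩
  · have := (NormedSpace.inclusionInDoubleDualLi (E := X) ℝ).norm_map z
    rw [← this]
    simp only [mem_preimage, mem_closedBall_zero_iff] at hΨ
    rw [← hz] at hΨ
    exact hΨ
  · intro h c hc
    have h1 := aux_cluster hcl h c hc
    rw [← h1]
    exact congrArg (fun q : StrongDual ℝ (StrongDual ℝ X) => q h) hz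

lemma aux_subseq {X : Type*} [NormedAddCommGroup X] [NormedSpace ℝ X]
    (hrefl : Function.Surjective (NormedSpace.inclusionInDoubleDual ℝ X))
    (f : ℕ → StrongDual ℝ X) (hf : ∀ n, ‖f n‖ ≤ 1) :
    ∃ (g : StrongDual ℝ X) (φ : ℕ → ℕ), ‖g‖ ≤ 1 ∧ StrictMono φ ∧
      ∀ x, Tendsto (fun n => f (φ n) x) atTop (𝓝 (g x)) := by
  set M := (Submodule.span ℝ (range f)).topologicalClosure with hM
  have hMc : IsClosed (M : Set (StrongDual ℝ X)) := Submodule.isClosed_topologicalClosure _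
  have hfM : ∀ n, f n ∈ M := fun n =>
    Submodule.le_topologicalClosure _ (Submodule.subset_span (mem_range_self n))
  have hsep : TopologicalSpace.IsSeparable (M : Set (StrongDual ℝ X)) :=
    ((countable_range f).isSeparable.span (R := ℝ)).closure
  obtain ⟨c, hcc, hcM⟩ := hsep
  have : Countable c := hcc.to_subtype
  choose x hx1 hx2 using aux_attain hrefl
  have hcomp : IsCompact (Set.pi univ (fun _ : c => Icc (-1 : ℝ) 1)) :=
    isCompact_univ_pi fun _ => isCompact_Icc
  obtain ⟨a, -, φ, hφ, ha⟩ := hcomp.tendsto_subseq (x := fun n (g : c) => f n (x g)) (by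
    intro n g _
    rw [mem_Icc, ← abs_le]
    calc |f n (x g)| ≤ ‖f n‖ * ‖x g‖ := (f n).le_opNorm _
      _ ≤ 1 * 1 := by gcongr; exacts [hf n, hx1 _]
      _ = 1 := one_mul 1)
  rw [tendsto_pi_nhds] at ha
  have hK := WeakDual.isCompact_closedBall (𝕜 := ℝ) (E := X) 0 1
  let F : ℕ → WeakDual ℝ X := fun n => StrongDual.toWeakDual (f (φ n))
  have hmem : ∀ n, F n ∈ WeakDual.toStrongDual ⁻¹' closedBall (0 : StrongDual ℝ X) 1 := by
    intro n
    simp only [mem_preimage, mem_closedBall_zero_iff]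
    exact hf _
  obtain ⟨G, hG, hcl⟩ := hK.exists_mapClusterPt (f := atTop) (u := F)
    (tendsto_principal.mpr (Eventually.of_forall hmem))
  have hclM : ∀ H : WeakDual ℝ X, MapClusterPt H atTop F → WeakDual.toStrongDual H ∈ M := by
    intro H hH
    by_contra hne
    obtain ⟨Φ, h1, h2⟩ := aux_sep M hMc _ hne
    obtain ⟨w, rfl⟩ := hrefl Φ
    apply h1
    refine aux_cluster hH w 0 ?_
    refine tendsto_const_nhds.congr fun n => ?_
    exact (h2 _ (hfM (φ n))).symm
  have huniq : ∀ H : WeakDual ℝ X, MapClusterPt H atTop F → H = G := by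
    intro H hH
    set w := WeakDual.toStrongDual H - WeakDual.toStrongDual G with hw
    have hwM : w ∈ M := M.sub_mem (hclM H hH) (hclM G hcl)
    have hw0 : ∀ g ∈ c, w (x g) = 0 := by
      intro g hg
      have e1 := aux_cluster hH (x g) _ (ha ⟨g, hg⟩)
      have e2 := aux_cluster hcl (x g) _ (ha ⟨g, hg⟩)
      have : w (x g) = H (x g) - G (x g) := rfl
      rw [this, e1, e2, sub_self]
    have hwz : w = 0 := by
      by_contra hne
      have hpos : 0 < ‖w‖ := norm_pos_iff.mpr hne
      obtain ⟨g, hg, hd⟩ := Metric.mem_closure_iff.mp (hcM hwM) (‖w‖ / 2) (by linarith)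
      rw [dist_eq_norm, norm_sub_rev] at hd
      have h1 : ‖g‖ ≤ ‖g - w‖ := by
        calc ‖g‖ = (g - w) (x g) := by
              rw [ContinuousLinearMap.sub_apply, hw0 g hg, hx2, sub_zero]
          _ ≤ ‖(g - w) (x g)‖ := le_abs_self _
          _ ≤ ‖g - w‖ * ‖x g‖ := (g - w).le_opNorm _
          _ ≤ ‖g - w‖ * 1 := by gcongr; exact hx1 _
          _ = ‖g - w‖ := mul_one _
      have h2 : ‖w‖ ≤ ‖g‖ + ‖g - w‖ := by
        have := norm_sub_le g (g - w)
        rwa [sub_sub_cancel] at this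
      linarith
    exact WeakDual.toStrongDual.injective (sub_eq_zero.mp hwz)
  have hlim : Tendsto F atTop (𝓝 G) :=
    hK.tendsto_nhds_of_unique_mapClusterPt (Eventually.of_forall hmem)
      (fun H _ hH => huniq H hH)
  refine ⟨WeakDual.toStrongDual G, φ, ?_, hφ, fun w => ?_⟩
  · simpa only [mem_preimage, mem_closedBall_zero_iff] using hG
  · exact ((WeakDual.eval_continuous w).tendsto G).comp hlim

theorem not_stronglyAntiCoproximinal_of_strictConvex [CompleteSpace X]
    [StrictConvexSpace ℝ X]
    (hrefl : Function.Surjective (NormedSpace.inclusionInDoubleDual ℝ X))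
    (hKK : KadetsKlee (StrongDual ℝ X))
    (Y : Submodule ℝ X) (hYclosed : IsClosed (Y : Set X)) (hY : Y ≠ ⊤) :
    ¬ StronglyAntiCoproximinal Y := by
  intro hS
  obtain ⟨x, hx⟩ : ∃ x, x ∉ Y := by
    by_contra! h
    exact hY (Submodule.eq_top_iff'.mpr h)
  obtain ⟨g, hgx, hgY⟩ := aux_sep Y hYclosed x hx
  have hgpos : 0 < ‖g‖ := norm_pos_iff.mpr (by rintro rfl; simp at hgx)
  obtain ⟨z, hz1, hgz⟩ := aux_attain hrefl g
  have hzY : z ∉ Y := fun h => by rw [hgY z h] at hgz; exact hgpos.ne hgz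
  have hz : ‖z‖ = 1 := by
    refine le_antisymm hz1 ?_
    have := (le_abs_self _).trans (g.le_opNorm z)
    rw [hgz] at this
    nlinarith
  -- the approximating sequence
  have hseq : ∀ n : ℕ, ∃ (y : X) (f : StrongDual ℝ X), y ∈ Y ∧ ‖y‖ ≤ 1 ∧ ‖f‖ = 1 ∧ f y = 1 ∧
      1 - 1 / ((n : ℝ) + 1) ≤ f z := by
    intro n
    have hn : (0 : ℝ) < (n : ℝ) + 1 := by positivity
    have hlt : 0 < 1 / ((n : ℝ) + 1) := by positivity
    have hle : 1 / ((n : ℝ) + 1) ≤ 1 := by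
      rw [div_le_one hn]; linarith [(Nat.cast_nonneg n : (0 : ℝ) ≤ n)]
    have h := hS z hzY (1 - 1 / ((n : ℝ) + 1)) (by linarith) (by linarith)
    have h' : ¬ IsEpsBestCoapprox Y (1 - 1 / ((n : ℝ) + 1)) z 0 := fun hh =>
      h ⟨0, Y.zero_mem, hh⟩
    unfold IsEpsBestCoapprox ApproxBJOrth at h'
    push Not at h'
    obtain ⟨y, hyY, t, ht⟩ := h'
    rw [sub_zero, norm_smul, hz, mul_one, Real.norm_eq_abs] at ht
    set ε := 1 - 1 / ((n : ℝ) + 1) with hε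
    have hε0 : 0 ≤ ε := by linarith
    have hy0 : ‖y‖ ≠ 0 := by
      intro h0
      rw [h0] at ht
      have := norm_nonneg (y + t • z)
      nlinarith [abs_nonneg t]
    obtain ⟨f, hf1, hfy⟩ := exists_dual_vector ℝ y hy0
    have hfy : f y = ‖y‖ := by simpa using hfy
    have h1 : f y + t * f z ≤ ‖y + t • z‖ := by
      have := (le_abs_self _).trans (f.le_opNorm (y + t • z))
      rw [hf1, one_mul, map_add, map_smul, smul_eq_mul] at this
      exact this
    have h2 : ε * |t| < -(t * f z) := by linarith
    have h3 : ε ≤ |f z| := by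
      by_contra! hc
      have : -(t * f z) ≤ |t| * |f z| := by rw [← abs_mul]; exact neg_le_abs _
      nlinarith [abs_nonneg t]
    have hny : ‖(‖y‖⁻¹ • y)‖ = 1 := by
      rw [norm_smul, norm_inv, norm_norm, inv_mul_cancel₀ hy0]
    have hfny : f (‖y‖⁻¹ • y) = 1 := by
      rw [map_smul, smul_eq_mul, hfy, inv_mul_cancel₀ hy0]
    rcases le_abs.mp h3 with h4 | h4
    · exact ⟨‖y‖⁻¹ • y, f, Y.smul_mem _ hyY, hny.le, hf1, hfny, h4⟩
    · refine ⟨-(‖y‖⁻¹ • y), -f, Y.neg_mem (Y.smul_mem _ hyY), by rw [norm_neg, hny],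
        by rw [norm_neg, hf1], ?_, h4⟩
      rw [ContinuousLinearMap.neg_apply, map_neg, neg_neg, hfny]
  choose y f hyY hy1 hf1 hfy hfz using hseq
  obtain ⟨F, φ, hF1, hφ, hlim⟩ := aux_subseq hrefl f (fun n => (hf1 n).le)
  have hFz : 1 ≤ F z := by
    have h1 : Tendsto (fun n : ℕ => 1 - 1 / ((n : ℝ) + 1)) atTop (𝓝 (1 - 0)) :=
      tendsto_const_nhds.sub tendsto_one_div_add_atTop_nhds_zero_nat
    rw [sub_zero] at h1
    exact le_of_tendsto_of_tendsto' (h1.comp hφ.tendsto_atTop) (hlim z) (fun n => hfz (φ n))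
  have hFn : ‖F‖ = 1 := by
    refine le_antisymm hF1 ?_
    have := (le_abs_self _).trans (F.le_opNorm z)
    rw [hz, mul_one] at this
    exact hFz.trans this
  have hnorm : Tendsto (fun n => f (φ n)) atTop (𝓝 F) := by
    apply hKK
    · intro Φ
      obtain ⟨w, rfl⟩ := hrefl Φ
      exact hlim w
    · simp only [hf1, hFn]
      exact tendsto_const_nhds
  obtain ⟨w, hw1, hw⟩ := aux_ball hrefl (fun n => y (φ n)) (fun n => hy1 _)
  have hwY : w ∈ Y := by
    by_contra hne
    obtain ⟨h, h1, h2⟩ := aux_sep Y hYclosed w hne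
    exact h1 (hw h 0 (tendsto_const_nhds.congr fun n => (h2 _ (hyY (φ n))).symm))
  have hFw : F w = 1 := by
    apply hw
    rw [tendsto_iff_norm_sub_tendsto_zero] at hnorm ⊢
    refine squeeze_zero (fun _ => norm_nonneg _) (fun n => ?_) hnorm
    have h1 : F (y (φ n)) - 1 = -((f (φ n) - F) (y (φ n))) := by
      rw [ContinuousLinearMap.sub_apply, hfy]; ring
    rw [h1, norm_neg]
    calc _ ≤ ‖f (φ n) - F‖ * ‖y (φ n)‖ := (f (φ n) - F).le_opNorm _
      _ ≤ ‖f (φ n) - F‖ * 1 := by gcongr; exact hy1 _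
      _ = _ := mul_one _
  have hwn : ‖w‖ = 1 := by
    refine le_antisymm hw1 ?_
    have := (le_abs_self _).trans (F.le_opNorm w)
    rw [hFn, one_mul, hFw] at this
    exact this
  have heq : w = z := by
    refine eq_of_norm_eq_of_norm_add_eq (hwn.trans hz.symm) (le_antisymm (norm_add_le _ _) ?_)
    have := (le_abs_self _).trans (F.le_opNorm (w + z))
    rw [hFn, one_mul, map_add, hFw] at this
    rw [hwn, hz]
    linarith
  exact hzY (heq ▸ hwY)
end

section
/- Let X be a reflexive smooth real Banach space whose dual X* satisfies the Kadets-Klee property. Then no proper closed linear subspace of X is a strongly anti-coproximinal subspace of X. -/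
open Metric Set

variable {X : Type*} [NormedAddCommGroup X] [NormedSpace ℝ X]

theorem exists_support_aux (Y : Submodule ℝ X) (x : X) (hx : ‖x‖ = 1) (ε : ℝ) (hε : 0 ≤ ε)
    (h : ¬ IsEpsBestCoapprox Y ε x 0) :
    ∃ f : StrongDual ℝ X, ‖f‖ = 1 ∧ ε < f x ∧ ∃ y ∈ Y, ‖y‖ = 1 ∧ f y = 1 := by
  unfold IsEpsBestCoapprox ApproxBJOrth at h
  push Not at h
  obtain ⟨y, hyY, t, ht⟩ := h
  rw [sub_zero, norm_smul, hx, mul_one, Real.norm_eq_abs] at ht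
  have hy : ‖y‖ ≠ 0 := by
    intro h0
    have h1 := norm_nonneg (y + t • x)
    have h2 := mul_nonneg hε (abs_nonneg t)
    linarith
  obtain ⟨f, hf, hfy⟩ := exists_dual_vector ℝ y hy
  have h3 : f (y + t • x) ≤ ‖y + t • x‖ := by
    have := f.le_opNorm (y + t • x)
    rw [hf, one_mul] at this
    exact (le_abs_self _).trans this
  have hfy' : f y = ‖y‖ := by simpa using hfy
  rw [map_add, map_smul, smul_eq_mul, hfy'] at h3
  have h4 : t * f x < - (ε * |t|) := by linarith
  rcases le_or_gt 0 t with h0 | h0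
  · rw [abs_of_nonneg h0] at h4
    refine ⟨-f, by simpa using hf, ?_, -(‖y‖⁻¹ • y), Y.neg_mem (Y.smul_mem _ hyY), ?_, ?_⟩
    · by_contra hc
      have : -f x ≤ ε := by simpa using hc
      nlinarith
    · rw [norm_neg, norm_smul, norm_inv, norm_norm, inv_mul_cancel₀ hy]
    · simp [hfy', hy]
  · rw [abs_of_neg h0] at h4
    refine ⟨f, hf, ?_, ‖y‖⁻¹ • y, Y.smul_mem _ hyY, ?_, ?_⟩
    · by_contra hc
      push Not at hc
      nlinarith
    · rw [norm_smul, norm_inv, norm_norm, inv_mul_cancel₀ hy]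
    · simp [hfy', hy]

theorem exists_annihilator_aux (Y : Submodule ℝ X) (hYclosed : IsClosed (Y : Set X)) (hY : Y ≠ ⊤) :
    ∃ g : StrongDual ℝ X, ‖g‖ = 1 ∧ ∀ y ∈ Y, g y = 0 := by
  obtain ⟨x, hx⟩ : ∃ x, x ∉ Y := by
    by_contra hc
    push Not at hc
    exact hY ((Submodule.eq_top_iff').2 hc)
  obtain ⟨g, u, h1, h2⟩ := geometric_hahn_banach_closed_point (Y.convex) hYclosed hx
  have h0 : ∀ y ∈ Y, g y = 0 := by
    intro y hy
    by_contra hc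
    have := h1 ((u / g y) • y) (Y.smul_mem _ hy)
    rw [map_smul, smul_eq_mul, div_mul_cancel₀ _ hc] at this
    exact lt_irrefl _ this
  have hu : 0 < u := by simpa using h1 0 Y.zero_mem
  have hg : ‖g‖ ≠ 0 := by
    intro h
    rw [norm_eq_zero] at h
    subst h
    simp at h2
    linarith
  refine ⟨‖g‖⁻¹ • g, ?_, fun y hy => by simp [h0 y hy]⟩
  rw [norm_smul, norm_inv, norm_norm, inv_mul_cancel₀ hg]

theorem not_stronglyAntiCoproximinal_of_smooth [CompleteSpace X]
    (hsm : SmoothSpace X)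
    (hrefl : Function.Surjective (NormedSpace.inclusionInDoubleDual ℝ X))
    (hKK : KadetsKlee (StrongDual ℝ X))
    (Y : Submodule ℝ X) (hYclosed : IsClosed (Y : Set X)) (hY : Y ≠ ⊤) :
    ¬ StronglyAntiCoproximinal Y := by
  intro hS
  obtain ⟨g, hg, hgY⟩ := exists_annihilator_aux Y hYclosed hY
  obtain ⟨φ, hφ, hφg⟩ := exists_dual_vector ℝ g (by rw [hg]; exact one_ne_zero)
  obtain ⟨x, rfl⟩ := hrefl φ
  have hgx : g x = 1 := by simpa [hg] using hφg
  have hx : ‖x‖ = 1 := by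
    rw [← (NormedSpace.inclusionInDoubleDualLi (E := X) ℝ).norm_map x]
    exact hφ
  have hx0 : x ≠ 0 := by
    rintro rfl
    simp at hx
  have hxY : x ∉ Y := fun h => by
    have := hgY x h
    linarith
  obtain ⟨-, g', hg'⟩ := hsm x hx0
  have huniq : ∀ f : StrongDual ℝ X, ‖f‖ = 1 → f x = 1 → f = g := by
    intro f hf hfx
    have h1 : f ∈ normingSet x := ⟨hf, by rw [hfx, hx]⟩
    have h2 : g ∈ normingSet x := ⟨hg, by rw [hgx, hx]⟩
    rw [hg'] at h1 h2
    exact h1.trans h2.symm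
  have key : ∀ n : ℕ, ∃ f : StrongDual ℝ X, ‖f‖ = 1 ∧ 1 - 1 / ((n : ℝ) + 1) < f x ∧
      ∃ y ∈ Y, ‖y‖ = 1 ∧ f y = 1 := by
    intro n
    have hpos : (0 : ℝ) < 1 / ((n : ℝ) + 1) := by positivity
    have hle : 1 / ((n : ℝ) + 1) ≤ 1 := by
      rw [div_le_one (by positivity)]
      have : (0 : ℝ) ≤ n := n.cast_nonneg
      linarith
    refine exists_support_aux Y x hx _ (by linarith) fun h => ?_
    exact hS x hxY (1 - 1 / ((n : ℝ) + 1)) (by linarith) (by linarith) ⟨0, Y.zero_mem, h⟩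
  choose f hf hfx y hyY hy hfy using key
  have hfle : ∀ (h : StrongDual ℝ X), ‖h‖ ≤ 1 → h x ≤ 1 := by
    intro h hh
    have := h.le_opNorm x
    rw [hx, mul_one] at this
    exact (le_abs_self _).trans (this.trans hh)
  have hlim : Filter.Tendsto (fun n => f n x) Filter.atTop (nhds 1) := by
    have h1 : Filter.Tendsto (fun n : ℕ => 1 - 1 / ((n : ℝ) + 1)) Filter.atTop (nhds (1 - 0)) :=
      tendsto_const_nhds.sub tendsto_one_div_add_atTop_nhds_zero_nat
    rw [sub_zero] at h1
    exact tendsto_of_tendsto_of_tendsto_of_le_of_le h1 tendsto_const_nhds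
      (fun n => (hfx n).le) (fun n => hfle _ (hf n).le)
  have hweak : Filter.Tendsto (fun n => StrongDual.toWeakDual (f n)) Filter.atTop
      (nhds (StrongDual.toWeakDual g)) := by
    refine (WeakDual.isCompact_closedBall (𝕜 := ℝ) (0 : StrongDual ℝ X)
      1).tendsto_nhds_of_unique_mapClusterPt (.of_forall fun n => ?_) ?_
    · simp [hf n]
    · intro a ha hcl
      have ha1 : ‖WeakDual.toStrongDual a‖ ≤ 1 := by simpa using ha
      have hcl' := hcl.continuousAt_comp (WeakDual.eval_continuous (𝕜 := ℝ) x).continuousAt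
      have hax : a x = 1 := by
        have : ClusterPt (a x) (nhds (1 : ℝ)) := ClusterPt.mono hcl' hlim
        exact eq_of_nhds_neBot this
      have hnorm : ‖WeakDual.toStrongDual a‖ = 1 := by
        refine le_antisymm ha1 ?_
        have := (WeakDual.toStrongDual a).le_opNorm x
        rw [hx, mul_one, WeakDual.toStrongDual_apply, hax] at this
        simpa using this
      have := huniq _ hnorm hax
      rw [← this]
      rfl
  have hconv : Filter.Tendsto f Filter.atTop (nhds g) := by
    refine hKK f g (fun φ => ?_) (by simp [hf, hg])
    obtain ⟨z, rfl⟩ := hrefl φ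
    exact ((WeakDual.eval_continuous (𝕜 := ℝ) z).tendsto _).comp hweak
  have hz := tendsto_iff_norm_sub_tendsto_zero.1 hconv
  have hge : ∀ n, 1 ≤ ‖f n - g‖ := by
    intro n
    have := (f n - g).le_opNorm (y n)
    simpa [hy n, hfy n, hgY _ (hyY n)] using this
  have := ge_of_tendsto' hz hge
  linarith
end
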